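/- Let f : (0,∞) → ℝ admit the representation f(t) = a + b·t + ∫₀^∞ (tλ)/(t+λ) dw(λ) for all t > 0, where a ∈ ℝ, b ≥ 0 and w is a positive measure on (0,∞) with ∫₀^∞ λ/(1+λ) dw(λ) < ∞, and let f̃(t) := t·f(1/t). Then for all strictly positive operators C, D, Q on a complex Hilbert space H, 𝒫_{f̃}(D,Q) − 𝒫_{f̃}(C,Q) = a(D − C) + ∫₀^∞ λ [ ∫₀¹ Q (Q + λ((1−t)C + tD))⁻¹ (D − C) (Q + λ((1−t)C + tD))⁻¹ Q dt ] dw(λ). -/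

import Mathlib

open MeasureTheory

variable {H : Type*} [NormedAddCommGroup H] [InnerProductSpace ℂ H] [CompleteSpace H]

/-- An operator `T` on a complex Hilbert space is *strictly positive* if
`⟪T x, x⟫ ≥ 0` for all `x` and `T` is invertible. -/
def StrictlyPos (T : H →L[ℂ] H) : Prop := T.IsPositive ∧ IsUnit T

/-- `A^{1/2}` via the continuous functional calculus. -/
noncomputable def opSqrt (A : H →L[ℂ] H) : H →L[ℂ] H := cfc Real.sqrt A

/-- `A^{-1/2}` via the continuous functional calculus. -/
noncomputable def opInvSqrt (A : H →L[ℂ] H) : H →L[ℂ] H :=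
  cfc (fun x : ℝ => (Real.sqrt x)⁻¹) A

/-- The noncommutative perspective `𝒫_f(B, A) := A^{1/2} f(A^{-1/2} B A^{-1/2}) A^{1/2}`. -/
noncomputable def persp (f : ℝ → ℝ) (B A : H →L[ℂ] H) : H →L[ℂ] H :=
  opSqrt A * cfc f (opInvSqrt A * B * opInvSqrt A) * opSqrt A

/-- The weighted operator geometric mean `A ♯_ν B := A^{1/2} (A^{-1/2} B A^{-1/2})^ν A^{1/2}`. -/
noncomputable def gmean (ν : ℝ) (A B : H →L[ℂ] H) : H →L[ℂ] H :=
  opSqrt A * cfc (fun x : ℝ => x ^ ν) (opInvSqrt A * B * opInvSqrt A) * opSqrt A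

/-- The relative operator entropy `S(A|B) := A^{1/2} ln(A^{-1/2} B A^{-1/2}) A^{1/2}`. -/
noncomputable def relEntropy (A B : H →L[ℂ] H) : H →L[ℂ] H :=
  opSqrt A * cfc Real.log (opInvSqrt A * B * opInvSqrt A) * opSqrt A

theorem StrictlyPos.isStrictlyPositive {T : H →L[ℂ] H} (h : StrictlyPos T) :
    IsStrictlyPositive T :=
  IsStrictlyPositive.iff_of_unital.2 ⟨(ContinuousLinearMap.nonneg_iff_isPositive T).2 h.1, h.2⟩

theorem IsStrictlyPositive.strictlyPos {T : H →L[ℂ] H} (h : IsStrictlyPositive T) :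
    StrictlyPos T :=
  ⟨(ContinuousLinearMap.nonneg_iff_isPositive T).1 h.nonneg, h.isUnit⟩

theorem StrictlyPos.isSelfAdjoint {T : H →L[ℂ] H} (h : StrictlyPos T) : IsSelfAdjoint T :=
  h.isStrictlyPositive.nonneg.isSelfAdjoint

theorem StrictlyPos.spectrum_pos {T : H →L[ℂ] H} (h : StrictlyPos T) {x : ℝ}
    (hx : x ∈ spectrum ℝ T) : 0 < x := by
  have h0 : 0 ≤ x := spectrum_nonneg_of_nonneg h.isStrictlyPositive.nonneg hx
  refine lt_of_le_of_ne h0 ?_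
  rintro rfl
  exact spectrum.zero_notMem ℝ h.2 hx

theorem StrictlyPos.add_smul {A B : H →L[ℂ] H} (hA : StrictlyPos A) (hB : StrictlyPos B) {l : ℝ}
    (hl : 0 ≤ l) : StrictlyPos (A + l • B) :=
  (hA.isStrictlyPositive.add_nonneg
    (smul_nonneg hl hB.isStrictlyPositive.nonneg)).strictlyPos

theorem StrictlyPos.smul {A : H →L[ℂ] H} (hA : StrictlyPos A) {c : ℝ} (hc : 0 < c) :
    StrictlyPos (c • A) := by
  refine ⟨(ContinuousLinearMap.nonneg_iff_isPositive _).1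
    (smul_nonneg hc.le hA.isStrictlyPositive.nonneg), ?_⟩
  exact hA.2.smul (Units.mk0 c hc.ne')

theorem StrictlyPos.segment {C D : H →L[ℂ] H} (hC : StrictlyPos C) (hD : StrictlyPos D) {t : ℝ}
    (ht : t ∈ Set.Icc (0 : ℝ) 1) : StrictlyPos ((1 - t) • C + t • D) := by
  rcases ht.2.eq_or_lt with rfl | h1
  · simpa using hD
  · exact (hC.smul (sub_pos.2 h1)).add_smul hD ht.1

theorem StrictlyPos.opSqrt_mul_self {A : H →L[ℂ] H} (hA : StrictlyPos A) :
    opSqrt A * opSqrt A = A := by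
  have := hA.isSelfAdjoint
  rw [opSqrt, ← cfc_mul Real.sqrt Real.sqrt A]
  conv_rhs => rw [← cfc_id ℝ A]
  exact cfc_congr fun x hx => Real.mul_self_sqrt (hA.spectrum_pos hx).le

theorem StrictlyPos.continuousOn_inv_sqrt {A : H →L[ℂ] H} (hA : StrictlyPos A) :
    ContinuousOn (fun x : ℝ => (Real.sqrt x)⁻¹) (spectrum ℝ A) :=
  Real.continuous_sqrt.continuousOn.inv₀ fun _ hx => (Real.sqrt_pos.2 (hA.spectrum_pos hx)).ne'

theorem StrictlyPos.opSqrt_mul_opInvSqrt {A : H →L[ℂ] H} (hA : StrictlyPos A) :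
    opSqrt A * opInvSqrt A = 1 := by
  have := hA.isSelfAdjoint
  rw [opSqrt, opInvSqrt, ← cfc_mul _ _ A (by fun_prop) hA.continuousOn_inv_sqrt, ← cfc_one ℝ A]
  exact cfc_congr fun x hx => mul_inv_cancel₀ (Real.sqrt_pos.2 (hA.spectrum_pos hx)).ne'

theorem StrictlyPos.opInvSqrt_mul_opSqrt {A : H →L[ℂ] H} (hA : StrictlyPos A) :
    opInvSqrt A * opSqrt A = 1 := by
  rw [opSqrt, opInvSqrt, cfc_commute_cfc]
  exact hA.opSqrt_mul_opInvSqrt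

theorem StrictlyPos.conj_opInvSqrt {A B : H →L[ℂ] H} (hA : StrictlyPos A) (hB : StrictlyPos B) :
    StrictlyPos (opInvSqrt A * B * opInvSqrt A) := by
  have hsa : IsSelfAdjoint (opInvSqrt A) := cfc_predicate _ A
  have hu : IsUnit (opInvSqrt A) :=
    ⟨⟨_, _, hA.opInvSqrt_mul_opSqrt, hA.opSqrt_mul_opInvSqrt⟩, rfl⟩
  exact ⟨(ContinuousLinearMap.nonneg_iff_isPositive _).1
    (hsa.conjugate_nonneg hB.isStrictlyPositive.nonneg), (hu.mul hB.2).mul hu⟩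

/-- Resolvent form of the functional calculus of `x ↦ x l / (1 + x l)`. -/
theorem StrictlyPos.cfc_div_eq {X : H →L[ℂ] H} (hX : StrictlyPos X) {l : ℝ} (hl : 0 ≤ l) :
    cfc (fun x : ℝ => x * l / (1 + x * l)) X = 1 - Ring.inverse (1 + l • X) := by
  have hsa := hX.isSelfAdjoint
  have hne : ∀ x ∈ spectrum ℝ X, 1 + x * l ≠ 0 := fun x hx =>
    (add_pos_of_pos_of_nonneg one_pos (mul_nonneg (hX.spectrum_pos hx).le hl)).ne'
  have hc : ContinuousOn (fun x : ℝ => (1 + x * l)⁻¹) (spectrum ℝ X) :=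
    ContinuousOn.inv₀ (by fun_prop) hne
  have hlin : cfc (fun x : ℝ => 1 + x * l) X = 1 + l • X := by
    rw [cfc_const_add _ _ X, map_one, ← cfc_const_mul_id l X]
    simp only [mul_comm]
  have hmul : cfc (fun x : ℝ => (1 + x * l)⁻¹) X * (1 + l • X) = 1 := by
    rw [← hlin, ← cfc_mul _ _ X hc (by fun_prop), ← cfc_one ℝ X]
    exact cfc_congr fun x hx => inv_mul_cancel₀ (hne x hx)
  have hmul' : (1 + l • X) * cfc (fun x : ℝ => (1 + x * l)⁻¹) X = 1 := by
    rw [← hlin, ← cfc_mul _ _ X (by fun_prop) hc, ← cfc_one ℝ X]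
    exact cfc_congr fun x hx => mul_inv_cancel₀ (hne x hx)
  have hinv : Ring.inverse (1 + l • X) = cfc (fun x : ℝ => (1 + x * l)⁻¹) X :=
    Ring.inverse_unit ⟨_, _, hmul', hmul⟩
  rw [hinv, ← cfc_one ℝ X, ← cfc_sub _ _ X (by fun_prop) hc]
  exact cfc_congr fun x hx => by
    have := hne x hx
    simp only [Pi.one_apply]
    field_simp
    ring

/-- On a spectrum in `(0, ∞)`, the kernel `x l / (1 + x l)` is dominated by a multiple of
`l / (1 + l)`. -/
theorem norm_div_le_max_mul {x l M : ℝ} (hx : 0 < x) (hl : 0 < l) (hM : x ≤ M) :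
    ‖x * l / (1 + x * l)‖ ≤ max M 1 * (l / (1 + l)) := by
  have hxl : 0 < x * l := mul_pos hx hl
  rw [Real.norm_of_nonneg (by positivity), ← mul_div_assoc,
    div_le_div_iff₀ (by positivity) (by positivity)]
  have h1 : x * l ≤ max M 1 * l := by gcongr; exact hM.trans (le_max_left _ _)
  have h2 : x * l * l ≤ max M 1 * (x * l * l) :=
    le_mul_of_one_le_left (by positivity) (le_max_right _ _)
  nlinarith

theorem exists_forall_mem_spectrum_le (X : H →L[ℂ] H) :
    ∃ M : ℝ, ∀ x ∈ spectrum ℝ X, x ≤ M :=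
  ⟨‖X‖ * ‖(1 : H →L[ℂ] H)‖, fun x hx =>
    (Real.le_norm_self x).trans (spectrum.norm_le_norm_mul_of_mem hx)⟩

section Representation

variable {w : Measure ℝ}

theorem continuousOn_uncurry_div {s : Set ℝ} (hs : s ⊆ Set.Ioi 0) :
    ContinuousOn (Function.uncurry fun l x : ℝ => x * l / (1 + x * l)) (Set.Ioi 0 ×ˢ s) := by
  refine ContinuousOn.div (by fun_prop) (by fun_prop) ?_
  rintro ⟨l, x⟩ ⟨hl, hx⟩
  exact (add_pos one_pos (mul_pos (hs hx) hl)).ne'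

theorem StrictlyPos.ae_norm_div_le {X : H →L[ℂ] H} (hX : StrictlyPos X) :
    ∃ M : ℝ, ∀ᵐ l ∂w.restrict (Set.Ioi 0), ∀ x ∈ spectrum ℝ X,
      ‖x * l / (1 + x * l)‖ ≤ M * (l / (1 + l)) := by
  obtain ⟨M, hM⟩ := exists_forall_mem_spectrum_le X
  exact ⟨max M 1, ae_restrict_of_forall_mem measurableSet_Ioi fun l hl x hx =>
    norm_div_le_max_mul (hX.spectrum_pos hx) hl (hM x hx)⟩

theorem StrictlyPos.integrableOn_cfc_div {X : H →L[ℂ] H} (hX : StrictlyPos X)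
    (hw : IntegrableOn (fun l => l / (1 + l)) (Set.Ioi 0) w) :
    IntegrableOn (fun l => cfc (fun x : ℝ => x * l / (1 + x * l)) X) (Set.Ioi 0) w := by
  obtain ⟨M, hM⟩ := hX.ae_norm_div_le (w := w)
  exact integrableOn_cfc measurableSet_Ioi _ _ X
    (continuousOn_uncurry_div fun _ => hX.spectrum_pos) hM (hw.const_mul M).2 hX.isSelfAdjoint

theorem StrictlyPos.cfc_setIntegral_div {X : H →L[ℂ] H} (hX : StrictlyPos X)
    (hw : IntegrableOn (fun l => l / (1 + l)) (Set.Ioi 0) w) :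
    cfc (fun x : ℝ => ∫ l in Set.Ioi 0, x * l / (1 + x * l) ∂w) X =
      ∫ l in Set.Ioi 0, cfc (fun x : ℝ => x * l / (1 + x * l)) X ∂w := by
  obtain ⟨M, hM⟩ := hX.ae_norm_div_le (w := w)
  exact cfc_setIntegral measurableSet_Ioi _ _ X
    (continuousOn_uncurry_div fun _ => hX.spectrum_pos) hM (hw.const_mul M).2 hX.isSelfAdjoint

/-- The transpose of a function with the integral representation. -/
theorem transpose_eq {f : ℝ → ℝ} {a b : ℝ}
    (hrep : ∀ t > (0:ℝ), f t = a + b * t + ∫ l in Set.Ioi 0, t * l / (t + l) ∂w)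
    {x : ℝ} (hx : 0 < x) :
    x * f x⁻¹ = b + a * x + ∫ l in Set.Ioi 0, x * l / (1 + x * l) ∂w := by
  rw [hrep _ (inv_pos.2 hx), mul_add, mul_add, ← integral_const_mul]
  congr 1
  · field_simp
    ring
  · refine setIntegral_congr_fun measurableSet_Ioi fun l hl => ?_
    have hl : 0 < l := hl
    have : 0 < x * l := mul_pos hx hl
    field_simp

theorem StrictlyPos.conj_opSqrt_conj_opInvSqrt {Q : H →L[ℂ] H} (hQ : StrictlyPos Q)
    (C : H →L[ℂ] H) : opSqrt Q * (opInvSqrt Q * C * opInvSqrt Q) * opSqrt Q = C := by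
  simp only [mul_assoc, hQ.opInvSqrt_mul_opSqrt, mul_one]
  rw [← mul_assoc, hQ.opSqrt_mul_opInvSqrt, one_mul]

theorem StrictlyPos.conj_opSqrt_cfc_div {C Q : H →L[ℂ] H} (hC : StrictlyPos C)
    (hQ : StrictlyPos Q) {l : ℝ} (hl : 0 ≤ l) :
    opSqrt Q * cfc (fun x : ℝ => x * l / (1 + x * l)) (opInvSqrt Q * C * opInvSqrt Q) * opSqrt Q =
      Q - Q * Ring.inverse (Q + l • C) * Q := by
  have hX := hQ.conj_opInvSqrt hC
  have hSXS := hQ.conj_opSqrt_conj_opInvSqrt C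
  have hSS := hQ.opSqrt_mul_self
  have hS : IsUnit (opSqrt Q) := ⟨⟨_, _, hQ.opSqrt_mul_opInvSqrt, hQ.opInvSqrt_mul_opSqrt⟩, rfl⟩
  rw [hX.cfc_div_eq hl]
  set X := opInvSqrt Q * C * opInvSqrt Q
  set S := opSqrt Q
  have hfac : Q + l • C = S * (1 + l • X) * S := by
    rw [mul_add, add_mul, mul_one, hSS, mul_smul_comm, smul_mul_assoc, hSXS]
  have hcancel : Q * Ring.inverse (Q + l • C) * Q = S * Ring.inverse (1 + l • X) * S := by
    rw [hfac, Ring.inverse_mul (Or.inr hS), Ring.inverse_mul (Or.inl hS)]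
    conv_lhs => rw [← hSS]
    calc S * S * (Ring.inverse S * (Ring.inverse (1 + l • X) * Ring.inverse S)) * (S * S)
        = S * (S * Ring.inverse S) * Ring.inverse (1 + l • X) * (Ring.inverse S * S) * S := by
          noncomm_ring
      _ = _ := by rw [Ring.mul_inverse_cancel _ hS, Ring.inverse_mul_cancel _ hS, mul_one, mul_one]
  rw [hcancel, mul_sub, sub_mul, mul_one, hSS]

theorem integrableOn_sub_mul_inverse_mul {C Q : H →L[ℂ] H} (hC : StrictlyPos C)
    (hQ : StrictlyPos Q) (hw : IntegrableOn (fun l => l / (1 + l)) (Set.Ioi 0) w) :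
    IntegrableOn (fun l : ℝ => Q - Q * Ring.inverse (Q + l • C) * Q) (Set.Ioi 0) w :=
  IntegrableOn.congr_fun
    ((((hQ.conj_opInvSqrt hC).integrableOn_cfc_div hw).const_mul (opSqrt Q)).mul_const (opSqrt Q))
    (fun _ hl => hC.conj_opSqrt_cfc_div hQ (le_of_lt hl)) measurableSet_Ioi

/-- The perspective of the transpose as an integral of resolvents. -/
theorem persp_transpose_eq {f : ℝ → ℝ} {a b : ℝ} {C Q : H →L[ℂ] H}
    (hC : StrictlyPos C) (hQ : StrictlyPos Q) (hf : ContinuousOn f (Set.Ioi 0))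
    (hw : IntegrableOn (fun l => l / (1 + l)) (Set.Ioi 0) w)
    (hrep : ∀ t > (0:ℝ), f t = a + b * t + ∫ l in Set.Ioi 0, t * l / (t + l) ∂w) :
    persp (fun t : ℝ => t * f t⁻¹) C Q = b • Q + a • C +
      ∫ l in Set.Ioi (0:ℝ), (Q - Q * Ring.inverse (Q + l • C) * Q) ∂w := by
  have hX := hQ.conj_opInvSqrt hC
  have hSXS := hQ.conj_opSqrt_conj_opInvSqrt C
  have hint := hX.integrableOn_cfc_div hw
  have hker : ∫ l in Set.Ioi (0:ℝ), (Q - Q * Ring.inverse (Q + l • C) * Q) ∂w =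
      ∫ l in Set.Ioi (0:ℝ), opSqrt Q * cfc (fun x : ℝ => x * l / (1 + x * l))
        (opInvSqrt Q * C * opInvSqrt Q) * opSqrt Q ∂w :=
    setIntegral_congr_fun measurableSet_Ioi fun l hl =>
      (hC.conj_opSqrt_cfc_div hQ (le_of_lt hl)).symm
  rw [hker, persp]
  set X := opInvSqrt Q * C * opInvSqrt Q
  have hsa := hX.isSelfAdjoint
  have hcont : ContinuousOn (fun x : ℝ => ∫ l in Set.Ioi 0, x * l / (1 + x * l) ∂w)
      (spectrum ℝ X) := by
    have h : ContinuousOn (fun x : ℝ => x * f x⁻¹ - (b + a * x)) (spectrum ℝ X) := by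
      refine ContinuousOn.sub (continuousOn_id.mul (hf.comp ?_ ?_)) (by fun_prop)
      · exact continuousOn_id.inv₀ fun x hx => (hX.spectrum_pos hx).ne'
      · exact fun x hx => inv_pos.2 (hX.spectrum_pos hx)
    refine h.congr fun x hx => ?_
    beta_reduce
    rw [transpose_eq hrep (hX.spectrum_pos hx)]
    ring
  have hcfc : cfc (fun t : ℝ => t * f t⁻¹) X = b • 1 + a • X +
      ∫ l in Set.Ioi 0, cfc (fun x : ℝ => x * l / (1 + x * l)) X ∂w := by
    rw [cfc_congr fun x hx => transpose_eq hrep (hX.spectrum_pos hx),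
      cfc_add X (fun x => b + a * x) _ (by fun_prop) hcont, cfc_const_add b _ X,
      cfc_const_mul_id a X, hX.cfc_setIntegral_div hw, Algebra.algebraMap_eq_smul_one]
  have hleft : opSqrt Q * ∫ l in Set.Ioi 0, cfc (fun x : ℝ => x * l / (1 + x * l)) X ∂w =
      ∫ l in Set.Ioi 0, opSqrt Q * cfc (fun x : ℝ => x * l / (1 + x * l)) X ∂w :=
    (integral_const_mul_of_integrable hint).symm
  have hright : (∫ l in Set.Ioi 0, opSqrt Q * cfc (fun x : ℝ => x * l / (1 + x * l)) X ∂w) *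
      opSqrt Q =
      ∫ l in Set.Ioi 0, opSqrt Q * cfc (fun x : ℝ => x * l / (1 + x * l)) X * opSqrt Q ∂w :=
    (integral_mul_const_of_integrable (hint.const_mul (opSqrt Q))).symm
  rw [hcfc, mul_add, add_mul, hleft, hright, mul_add, add_mul, mul_smul_comm, smul_mul_assoc,
    mul_one, hQ.opSqrt_mul_self, mul_smul_comm, smul_mul_assoc, hSXS]

end Representation

/-- The resolvent difference as an integral along the segment from `C` to `D`. -/
theorem smul_integral_segment_eq {C D Q : H →L[ℂ] H} (hC : StrictlyPos C) (hD : StrictlyPos D)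
    (hQ : StrictlyPos Q) {l : ℝ} (hl : 0 ≤ l) :
    l • (∫ t in (0:ℝ)..1, Q * Ring.inverse (Q + l • ((1 - t) • C + t • D)) * (D - C) *
      Ring.inverse (Q + l • ((1 - t) • C + t • D)) * Q) =
      (Q - Q * Ring.inverse (Q + l • D) * Q) - (Q - Q * Ring.inverse (Q + l • C) * Q) := by
  set P : ℝ → H →L[ℂ] H := fun t => Q + l • ((1 - t) • C + t • D)
  have hP : ∀ t, HasDerivAt P (l • (D - C)) t := fun t => by
    have h1 : HasDerivAt (fun t : ℝ => (1 - t) • C) ((-1 : ℝ) • C) t :=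
      ((hasDerivAt_id t).const_sub 1).smul_const C
    have h2 : HasDerivAt (fun t : ℝ => t • D) ((1 : ℝ) • D) t :=
      (hasDerivAt_id t).smul_const D
    have h3 := ((h1.add h2).const_smul l).const_add Q
    exact h3.congr_deriv (by simp [sub_eq_neg_add])
  have hunit : ∀ t ∈ Set.uIcc (0:ℝ) 1, IsUnit (P t) := fun t ht => by
    rw [Set.uIcc_of_le zero_le_one] at ht
    exact (hQ.add_smul (hC.segment hD ht) hl).2
  have hinv : ∀ t ∈ Set.uIcc (0:ℝ) 1, HasDerivAt (fun s => Ring.inverse (P s))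
      (-(Ring.inverse (P t) * (l • (D - C)) * Ring.inverse (P t))) t := fun t ht => by
    obtain ⟨u, hu⟩ := hunit t ht
    have h := hasFDerivAt_ringInverse (𝕜 := ℝ) u
    rw [hu] at h
    exact (h.comp_hasDerivAt t (hP t)).congr_deriv (by simp [← hu])
  have hderiv : ∀ t ∈ Set.uIcc (0:ℝ) 1, HasDerivAt (fun s => -(Q * Ring.inverse (P s) * Q))
      (l • (Q * Ring.inverse (P t) * (D - C) * Ring.inverse (P t) * Q)) t := fun t ht => by
    exact (((hinv t ht).const_mul Q).mul_const Q).neg.congr_deriv (by simp [mul_assoc])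
  have hcinv : ContinuousOn (fun s => Ring.inverse (P s)) (Set.uIcc (0:ℝ) 1) :=
    fun t ht => (hinv t ht).continuousAt.continuousWithinAt
  have hcont : ContinuousOn
      (fun t => l • (Q * Ring.inverse (P t) * (D - C) * Ring.inverse (P t) * Q))
      (Set.uIcc (0:ℝ) 1) := by
    fun_prop
  rw [← intervalIntegral.integral_smul,
    intervalIntegral.integral_eq_sub_of_hasDerivAt hderiv hcont.intervalIntegrable]
  simp only [P, sub_self, sub_zero, zero_smul, one_smul, add_zero, zero_add]
  abel

/-- **Theorem 2.2.** If `f(t) = a + b t + ∫₀^∞ tλ/(t+λ) dw(λ)` on `(0,∞)` and `f̃(t) = t f(1/t)`,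
then for all strictly positive operators `C, D, Q`,
`𝒫_f̃(D,Q) - 𝒫_f̃(C,Q) = a(D - C) + ∫₀^∞ λ [∫₀¹ Q(Q + λ((1-t)C + tD))⁻¹ (D - C) (Q + λ((1-t)C + tD))⁻¹ Q dt] dw(λ)`. -/
theorem stmt_3 (f : ℝ → ℝ) (a b : ℝ) (hb : 0 ≤ b) (w : Measure ℝ)
    (hf : ContinuousOn f (Set.Ioi 0))
    (hw : IntegrableOn (fun l => l / (1 + l)) (Set.Ioi 0) w)
    (hrep : ∀ t > (0:ℝ), f t = a + b * t + ∫ l in Set.Ioi 0, t * l / (t + l) ∂w)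
    (C D Q : H →L[ℂ] H) (hC : StrictlyPos C) (hD : StrictlyPos D) (hQ : StrictlyPos Q) :
    persp (fun t : ℝ => t * f t⁻¹) D Q - persp (fun t : ℝ => t * f t⁻¹) C Q = a • (D - C) +
      ∫ l in Set.Ioi (0:ℝ), l •
        (∫ t in (0:ℝ)..1, Q * Ring.inverse (Q + l • ((1 - t) • C + t • D)) * (D - C) *
          Ring.inverse (Q + l • ((1 - t) • C + t • D)) * Q) ∂w := by
  have hCi := integrableOn_sub_mul_inverse_mul hC hQ hw
  have hDi := integrableOn_sub_mul_inverse_mul hD hQ hw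
  rw [setIntegral_congr_fun measurableSet_Ioi fun l hl =>
      smul_integral_segment_eq hC hD hQ (le_of_lt hl), integral_sub hDi hCi,
    persp_transpose_eq hD hQ hf hw hrep, persp_transpose_eq hC hQ hf hw hrep, smul_sub]
  abel
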